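/- arXiv:2207.08128 — 5 statements merged into one kernel-verified Lean document; each statement's English description precedes it below -/
import Mathlib

section
/- Let f(x) = ½‖A x^{m−1} − b‖², let x* ∈ ℝⁿ and δ₀ > 0, and set R = ‖x*‖ + δ₀. Then for all x, y ∈ ℝⁿ with ‖x − x*‖ ≤ δ₀ and ‖y − x*‖ ≤ δ₀, the Hessians satisfy ‖∇²f(x) − ∇²f(y)‖ ≤ L_f · ‖x − y‖ in spectral norm, where L_f = 2(m−1)(m−2)(2m−3)·‖A‖_F²·R^{2m−5} + (m−1)(m−2)(m−3)·‖b‖·‖A‖_F·R^{m−4} (when m = 3 the second term is 0 since its coefficient vanishes). -/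
open scoped BigOperators RealInnerProductSpace

noncomputable section

/-- Contraction of an order-`m` tensor `A` on `{1,…,n}` with `m - d` copies of the vector `x`,
yielding an order-`d` tensor: the first `d` indices are free, the last `m - d` are summed
against copies of `x`. -/
def contra (m n : ℕ) (A : (Fin m → Fin n) → ℝ) (x : EuclideanSpace ℝ (Fin n))
    (d : ℕ) (hd : d ≤ m) : (Fin d → Fin n) → ℝ :=
  fun i => ∑ j : Fin (m - d) → Fin n,
    A (fun k => Fin.append i j (Fin.cast (by omega) k)) * ∏ l, x (j l)

/-- `A x^{m-1}` as a vector in `ℝⁿ`. -/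
def tvec (m n : ℕ) (A : (Fin m → Fin n) → ℝ) (x : EuclideanSpace ℝ (Fin n))
    (h : 1 ≤ m) : EuclideanSpace ℝ (Fin n) :=
  (EuclideanSpace.equiv (Fin n) ℝ).symm fun i => contra m n A x 1 h ![i]

/-- `A x^{m-2}` as an `n × n` matrix. -/
def tmat (m n : ℕ) (A : (Fin m → Fin n) → ℝ) (x : EuclideanSpace ℝ (Fin n))
    (h : 2 ≤ m) : Matrix (Fin n) (Fin n) ℝ :=
  Matrix.of fun i j => contra m n A x 2 h ![i, j]

/-- The least-squares objective `f(x) = ½ ‖A x^{m-1} - b‖²`. -/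
def obj (m n : ℕ) (A : (Fin m → Fin n) → ℝ) (b : EuclideanSpace ℝ (Fin n))
    (h : 1 ≤ m) : EuclideanSpace ℝ (Fin n) → ℝ :=
  fun x => (1 / 2) * ‖tvec m n A x h - b‖ ^ 2

/-- Frobenius norm of a tensor (indexed family of reals). -/
def frob {ι : Type*} [Fintype ι] (T : ι → ℝ) : ℝ :=
  Real.sqrt (∑ i, T i ^ 2)

/-- Hessian matrix of `f` at `x` via the second iterated Fréchet derivative. -/
def hess (n : ℕ) (f : EuclideanSpace ℝ (Fin n) → ℝ) (x : EuclideanSpace ℝ (Fin n)) :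
    Matrix (Fin n) (Fin n) ℝ :=
  Matrix.of fun i j =>
    iteratedFDeriv ℝ 2 f x ![EuclideanSpace.single i 1, EuclideanSpace.single j 1]

/-- Support of a vector. -/
def supp {n : ℕ} (x : EuclideanSpace ℝ (Fin n)) : Finset (Fin n) :=
  Finset.univ.filter fun i => x i ≠ 0

/-- `ℓ₀`-"norm": number of nonzero entries. -/
def spars {n : ℕ} (x : EuclideanSpace ℝ (Fin n)) : ℕ := (supp x).card

/-- Principal submatrix indexed by a finite index set `T`. -/
def subMat {n : ℕ} (M : Matrix (Fin n) (Fin n) ℝ) (T : Finset (Fin n)) :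
    Matrix {i // i ∈ T} {i // i ∈ T} ℝ :=
  Matrix.of fun i j => M i.1 j.1

/-- Spectral norm of a (possibly rectangular) real matrix, i.e. the operator norm of the
induced map between Euclidean spaces. -/
def specNorm {α β : Type*} [Fintype α] [Fintype β] [DecidableEq β] (M : Matrix α β ℝ) : ℝ :=
  ‖LinearMap.toContinuousLinearMap (Matrix.toEuclideanLin M)‖

/-- Membership `z ∈ P_s(u)` for the hard-thresholding projection. -/
def inProj {n : ℕ} (s : ℕ) (u z : EuclideanSpace ℝ (Fin n)) : Prop :=
  spars z ≤ s ∧ ∀ w : EuclideanSpace ℝ (Fin n), spars w ≤ s → ‖u - z‖ ≤ ‖u - w‖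

/-- Membership `T ∈ 𝒯(x;η)`: `T` collects `s` indices of largest-magnitude entries of
`u = x - η ∇f(x)`. -/
def Tmem {n : ℕ} (f : EuclideanSpace ℝ (Fin n) → ℝ) (s : ℕ) (η : ℝ)
    (x : EuclideanSpace ℝ (Fin n)) (T : Finset (Fin n)) : Prop :=
  T.card = s ∧ ∀ i ∈ T, ∀ j ∉ T,
    |(x - η • gradient f x) j| ≤ |(x - η • gradient f x) i|

theorem specNorm_of_multilinear_le {n : ℕ}
    (B : ContinuousMultilinearMap ℝ (fun _ : Fin 2 => EuclideanSpace ℝ (Fin n)) ℝ) :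
    specNorm (Matrix.of fun i j => B ![EuclideanSpace.single i 1, EuclideanSpace.single j 1])
      ≤ ‖B‖ := by
  set M : Matrix (Fin n) (Fin n) ℝ :=
    Matrix.of fun i j => B ![EuclideanSpace.single i 1, EuclideanSpace.single j 1] with hM
  have expand (v : EuclideanSpace ℝ (Fin n)) : v = ∑ i, v i • EuclideanSpace.single i (1 : ℝ) := by
    ext k
    simp [Pi.single_apply]
  have key (w v : EuclideanSpace ℝ (Fin n)) :
      inner ℝ w (Matrix.toEuclideanLin M v) = B ![w, v] := by
    have hB : B ![w, v] = B fun a : Fin 2 =>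
        ∑ i, (![w, v] a) i • EuclideanSpace.single i (1 : ℝ) := by
      congr 1
      ext1 a
      exact expand _
    rw [hB, B.map_sum, ← (finTwoArrowEquiv (Fin n)).symm.sum_comp, Fintype.sum_prod_type]
    simp only [PiLp.inner_apply, Matrix.toLpLin_apply, Matrix.mulVec, dotProduct, hM,
      Matrix.of_apply]
    refine Finset.sum_congr rfl fun i _ => ?_
    simp only [RCLike.inner_apply, conj_trivial, Finset.sum_mul]
    refine Finset.sum_congr rfl fun j _ => ?_
    rw [B.map_smul_univ]
    have : (fun a : Fin 2 => EuclideanSpace.single ((finTwoArrowEquiv (Fin n)).symm (i, j) a)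
        (1 : ℝ)) = ![EuclideanSpace.single i 1, EuclideanSpace.single j 1] := by
      ext1 a
      fin_cases a <;> simp
    rw [this]
    simp
    ring
  refine ContinuousLinearMap.opNorm_le_bound _ (norm_nonneg _) fun v => ?_
  change ‖Matrix.toEuclideanLin M v‖ ≤ _
  set w := Matrix.toEuclideanLin M v
  have hw : ‖w‖ * ‖w‖ ≤ ‖w‖ * (‖B‖ * ‖v‖) := by
    calc ‖w‖ * ‖w‖ = B ![w, v] := by rw [← key, real_inner_self_eq_norm_mul_norm]
      _ ≤ ‖B ![w, v]‖ := Real.le_norm_self _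
      _ ≤ ‖B‖ * ∏ a, ‖(![w, v] : Fin 2 → _) a‖ := B.le_opNorm _
      _ = ‖w‖ * (‖B‖ * ‖v‖) := by simp; ring
  rcases (norm_nonneg w).eq_or_lt with h | h
  · rw [← h]; positivity
  · exact le_of_mul_le_mul_left hw h

section NormBounds

variable {E F : Type*} [NormedAddCommGroup E] [NormedSpace ℝ E] [NormedAddCommGroup F]

theorem norm_iteratedFDeriv_diagonal_le [NormedSpace ℝ F] {k : ℕ}
    (M : ContinuousMultilinearMap ℝ (fun _ : Fin k => E) F) (i : ℕ) (x : E) :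
    ‖iteratedFDeriv ℝ i (fun x => M fun _ => x) x‖
      ≤ k.descFactorial i * ‖M‖ * ‖x‖ ^ (k - i) := by
  let L : E →L[ℝ] (Fin k → E) := ContinuousLinearMap.pi fun _ => ContinuousLinearMap.id ℝ E
  have hL : ‖L‖ ≤ 1 := L.opNorm_le_bound zero_le_one fun v => by
    rw [one_mul]; exact (pi_norm_le_iff_of_nonneg (norm_nonneg v)).2 fun _ => le_rfl
  have hx : ‖L x‖ ≤ ‖x‖ := (pi_norm_le_iff_of_nonneg (norm_nonneg x)).2 fun _ => le_rfl
  have hcomp := L.iteratedFDeriv_comp_right (M.contDiff (n := i)) x le_rfl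
  change ‖iteratedFDeriv ℝ i (M ∘ L) x‖ ≤ _
  rw [hcomp]
  calc _ ≤ ‖iteratedFDeriv ℝ i M (L x)‖ * ∏ _ : Fin i, ‖L‖ :=
        ContinuousMultilinearMap.norm_compContinuousLinearMap_le _ _
    _ ≤ ‖iteratedFDeriv ℝ i M (L x)‖ * 1 := by
        gcongr; exact Finset.prod_le_one (fun _ _ => norm_nonneg _) fun _ _ => hL
    _ ≤ k.descFactorial i * ‖M‖ * ‖L x‖ ^ (k - i) := by
        simpa using M.norm_iteratedFDeriv_le i (L x)
    _ ≤ _ := by gcongr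

theorem norm_iteratedFDeriv_three_half_norm_sq_le [InnerProductSpace ℝ F] {G : E → F}
    (hG : ContDiff ℝ 3 G) (x : E) :
    ‖iteratedFDeriv ℝ 3 (fun x => (1 / 2 : ℝ) * ‖G x‖ ^ 2) x‖
      ≤ ‖G x‖ * ‖iteratedFDeriv ℝ 3 G x‖
        + 3 * ‖iteratedFDeriv ℝ 1 G x‖ * ‖iteratedFDeriv ℝ 2 G x‖ := by
  let B : F →L[ℝ] F →L[ℝ] ℝ := (1 / 2 : ℝ) • innerSL ℝ
  have hB : ‖B‖ ≤ 1 / 2 := by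
    refine B.opNorm_le_bound₂ (by norm_num) fun u v => ?_
    change ‖(1 / 2 : ℝ) * inner ℝ u v‖ ≤ _
    rw [norm_mul, mul_assoc, Real.norm_of_nonneg (by norm_num : (0 : ℝ) ≤ 1 / 2)]
    gcongr
    exact norm_inner_le_norm u v
  have hf : (fun x => (1 / 2 : ℝ) * ‖G x‖ ^ 2) = fun x => B (G x) (G x) := by
    ext x
    rw [← real_inner_self_eq_norm_sq]
    rfl
  rw [hf]
  have h := B.norm_iteratedFDeriv_le_of_bilinear hG hG x (n := 3) le_rfl
  refine h.trans ((mul_le_mul_of_nonneg_right hB (by positivity)).trans_eq ?_)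
  simp [Finset.sum_range_succ, Nat.choose]
  ring

end NormBounds

/-- The multilinear map in `m - 1` vectors whose diagonal is `x ↦ A x^{m-1}`. -/
def tmul (m n : ℕ) (A : (Fin m → Fin n) → ℝ) (h : 1 ≤ m) :
    ContinuousMultilinearMap ℝ (fun _ : Fin (m - 1) => EuclideanSpace ℝ (Fin n))
      (EuclideanSpace ℝ (Fin n)) :=
  ∑ j : Fin (m - 1) → Fin n,
    ((ContinuousMultilinearMap.mkPiAlgebra ℝ (Fin (m - 1)) ℝ).compContinuousLinearMap
      fun l => EuclideanSpace.proj (j l)).smulRight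
        (WithLp.toLp 2 fun i => A fun k => Fin.append ![i] j (Fin.cast (by omega) k))

theorem tmul_apply (m n : ℕ) (A : (Fin m → Fin n) → ℝ) (h : 1 ≤ m)
    (v : Fin (m - 1) → EuclideanSpace ℝ (Fin n)) :
    tmul m n A h v = ∑ j : Fin (m - 1) → Fin n, (∏ l, v l (j l)) •
      (WithLp.toLp 2 fun i => A fun k => Fin.append ![i] j (Fin.cast (by omega) k)) := by
  simp [tmul]

theorem tmul_diagonal (m n : ℕ) (A : (Fin m → Fin n) → ℝ) (h : 1 ≤ m)
    (x : EuclideanSpace ℝ (Fin n)) : tmul m n A h (fun _ => x) = tvec m n A x h := by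
  ext i
  simp [tmul_apply, tvec, contra, mul_comm]

theorem sum_sq_append_eq_frob_sq (m n : ℕ) (A : (Fin m → Fin n) → ℝ) (h : 1 ≤ m) :
    ∑ j : Fin (m - 1) → Fin n, ∑ i : Fin n,
      A (fun k => Fin.append ![i] j (Fin.cast (by omega) k)) ^ 2 = frob A ^ 2 := by
  obtain ⟨k, rfl⟩ : ∃ k, m = k + 1 := ⟨m - 1, by omega⟩
  rw [frob, Real.sq_sqrt (by positivity), ← (Fin.consEquiv fun _ => Fin n).sum_comp,
    Fintype.sum_prod_type, Finset.sum_comm]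
  refine Finset.sum_congr rfl fun i _ => Finset.sum_congr rfl fun j _ => ?_
  congr 2
  ext1 a
  simp only [Fin.consEquiv_apply, Matrix.vecCons]
  rw [Fin.append_left_eq_cons]
  rfl

theorem norm_tmul_le (m n : ℕ) (A : (Fin m → Fin n) → ℝ) (h : 1 ≤ m) :
    ‖tmul m n A h‖ ≤ frob A := by
  refine ContinuousMultilinearMap.opNorm_le_bound (Real.sqrt_nonneg _) fun v => ?_
  rw [tmul_apply]
  set C : (Fin (m - 1) → Fin n) → EuclideanSpace ℝ (Fin n) := fun j =>
    WithLp.toLp 2 fun i => A fun k => Fin.append ![i] j (Fin.cast (by omega) k)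
  have hC : √(∑ j, ‖C j‖ ^ 2) = frob A := by
    rw [← Real.sqrt_sq (show 0 ≤ frob A from Real.sqrt_nonneg _),
      ← sum_sq_append_eq_frob_sq m n A h]
    simp [C, EuclideanSpace.norm_sq_eq]
  have hv : √(∑ j : Fin (m - 1) → Fin n, |∏ l, v l (j l)| ^ 2) = ∏ l, ‖v l‖ := by
    rw [← Real.sqrt_sq (show 0 ≤ ∏ l, ‖v l‖ by positivity), ← Finset.prod_pow]
    simp_rw [EuclideanSpace.norm_sq_eq, Finset.prod_univ_sum, Fintype.piFinset_univ,
      Finset.abs_prod, ← Finset.prod_pow, Real.norm_eq_abs]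
  calc ‖∑ j, (∏ l, v l (j l)) • C j‖ ≤ ∑ j, |∏ l, v l (j l)| * ‖C j‖ := by
        refine (norm_sum_le _ _).trans_eq (Finset.sum_congr rfl fun j _ => ?_)
        rw [norm_smul, Real.norm_eq_abs]
    _ ≤ _ := Real.sum_mul_le_sqrt_mul_sqrt _ _ _
    _ = frob A * ∏ l, ‖v l‖ := by rw [hC, hv, mul_comm]

theorem contDiff_tvec_sub (m n : ℕ) (A : (Fin m → Fin n) → ℝ) (h : 1 ≤ m)
    (b : EuclideanSpace ℝ (Fin n)) (N : WithTop ℕ∞) :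
    ContDiff ℝ N fun x => tvec m n A x h - b := by
  simp_rw [← tmul_diagonal]
  exact ((tmul m n A h).contDiff.comp (contDiff_pi.2 fun _ => contDiff_id)).sub contDiff_const

theorem norm_iteratedFDeriv_tvec_sub_le (m n : ℕ) (A : (Fin m → Fin n) → ℝ) (h : 1 ≤ m)
    (b : EuclideanSpace ℝ (Fin n)) {i : ℕ} (hi : i ≠ 0) {x : EuclideanSpace ℝ (Fin n)} {R : ℝ}
    (hx : ‖x‖ ≤ R) :
    ‖iteratedFDeriv ℝ i (fun x => tvec m n A x h - b) x‖
      ≤ (m - 1).descFactorial i * frob A * R ^ (m - 1 - i) := by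
  have hT : ContDiff ℝ i fun x => tvec m n A x h := by
    simpa using contDiff_tvec_sub m n A h 0 i
  rw [fun_iteratedFDeriv_sub hT contDiff_const, iteratedFDeriv_const_of_ne hi]
  simp only [Pi.zero_apply, sub_zero]
  simp_rw [← tmul_diagonal]
  refine (norm_iteratedFDeriv_diagonal_le _ i x).trans ?_
  have := norm_tmul_le m n A h
  have : 0 ≤ frob A := Real.sqrt_nonneg _
  gcongr

theorem norm_tvec_sub_le (m n : ℕ) (A : (Fin m → Fin n) → ℝ) (h : 1 ≤ m)
    (b : EuclideanSpace ℝ (Fin n)) {x : EuclideanSpace ℝ (Fin n)} {R : ℝ} (hx : ‖x‖ ≤ R) :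
    ‖tvec m n A x h - b‖ ≤ frob A * R ^ (m - 1) + ‖b‖ := by
  refine (norm_sub_le _ _).trans (add_le_add_left ?_ _)
  rw [← tmul_diagonal]
  refine ((tmul m n A h).le_opNorm _).trans ?_
  have := norm_tmul_le m n A h
  have : 0 ≤ frob A := Real.sqrt_nonneg _
  simp only [Finset.prod_const, Finset.card_univ, Fintype.card_fin]
  gcongr

theorem norm_iteratedFDeriv_three_obj_le (m n : ℕ) (hm : 3 ≤ m) (A : (Fin m → Fin n) → ℝ)
    (h : 1 ≤ m) (b : EuclideanSpace ℝ (Fin n)) {x : EuclideanSpace ℝ (Fin n)} {R : ℝ}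
    (hx : ‖x‖ ≤ R) :
    ‖iteratedFDeriv ℝ 3 (obj m n A b h) x‖
      ≤ 2 * ((m : ℝ) - 1) * ((m : ℝ) - 2) * (2 * (m : ℝ) - 3) * frob A ^ 2 * R ^ (2 * m - 5)
        + ((m : ℝ) - 1) * ((m : ℝ) - 2) * ((m : ℝ) - 3) * ‖b‖ * frob A * R ^ (m - 4) := by
  have hR : 0 ≤ R := (norm_nonneg x).trans hx
  have ha : 0 ≤ frob A := Real.sqrt_nonneg _
  have h0 := norm_tvec_sub_le m n A h b hx
  have h1 := norm_iteratedFDeriv_tvec_sub_le m n A h b one_ne_zero hx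
  have h2 := norm_iteratedFDeriv_tvec_sub_le m n A h b two_ne_zero hx
  have h3 := norm_iteratedFDeriv_tvec_sub_le m n A h b three_ne_zero hx
  calc ‖iteratedFDeriv ℝ 3 (obj m n A b h) x‖
      ≤ _ := norm_iteratedFDeriv_three_half_norm_sq_le (contDiff_tvec_sub m n A h b 3) x
    _ ≤ (frob A * R ^ (m - 1) + ‖b‖)
          * ((m - 1).descFactorial 3 * frob A * R ^ (m - 1 - 3))
        + 3 * ((m - 1).descFactorial 1 * frob A * R ^ (m - 1 - 1))
          * ((m - 1).descFactorial 2 * frob A * R ^ (m - 1 - 2)) := by gcongr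
    _ = _ := by
      obtain ⟨k, rfl⟩ : ∃ k, m = k + 3 := ⟨m - 3, by omega⟩
      rcases k with _ | k
      · simp [Nat.descFactorial]
        ring
      · rw [show k + 1 + 3 - 1 = k + 3 by omega, show 2 * (k + 1 + 3) - 5 = 2 * k + 3 by omega,
          show k + 1 + 3 - 4 = k by omega]
        simp [Nat.descFactorial]
        ring

/-- locally restricted Hessian Lipschitz continuity of `f` near `x*`, with
constant `L_f = 2(m-1)(m-2)(2m-3)‖A‖_F² R^{2m-5} + (m-1)(m-2)(m-3)‖b‖‖A‖_F R^{m-4}`,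
`R = ‖x*‖ + δ₀`, in spectral norm. -/
theorem hessian_lipschitz (m n : ℕ) (hm : 3 ≤ m) (hn : 1 ≤ n)
    (A : (Fin m → Fin n) → ℝ)
    (hA : ∀ (σ : Equiv.Perm (Fin m)) (i : Fin m → Fin n), A (i ∘ σ) = A i)
    (b : EuclideanSpace ℝ (Fin n))
    (xs : EuclideanSpace ℝ (Fin n)) (δ₀ : ℝ) (hδ₀ : 0 < δ₀) :
    ∀ x y : EuclideanSpace ℝ (Fin n), ‖x - xs‖ ≤ δ₀ → ‖y - xs‖ ≤ δ₀ →
      specNorm (hess n (obj m n A b (by omega)) x - hess n (obj m n A b (by omega)) y)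
        ≤ (2 * ((m : ℝ) - 1) * ((m : ℝ) - 2) * (2 * (m : ℝ) - 3) * frob A ^ 2 *
              (‖xs‖ + δ₀) ^ (2 * m - 5)
            + ((m : ℝ) - 1) * ((m : ℝ) - 2) * ((m : ℝ) - 3) * ‖b‖ * frob A *
              (‖xs‖ + δ₀) ^ (m - 4)) * ‖x - y‖ := by
  intro x y hx hy
  have h : 1 ≤ m := by omega
  set L := 2 * ((m : ℝ) - 1) * ((m : ℝ) - 2) * (2 * (m : ℝ) - 3) * frob A ^ 2 *
      (‖xs‖ + δ₀) ^ (2 * m - 5)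
    + ((m : ℝ) - 1) * ((m : ℝ) - 2) * ((m : ℝ) - 3) * ‖b‖ * frob A * (‖xs‖ + δ₀) ^ (m - 4)
  have hf : ContDiff ℝ 3 (obj m n A b h) :=
    contDiff_const.mul ((contDiff_tvec_sub m n A h b 3).norm_sq ℝ)
  have hdiff : Differentiable ℝ (iteratedFDeriv ℝ 2 (obj m n A b h)) :=
    hf.differentiable_iteratedFDeriv (by norm_num)
  have hbound : ∀ z ∈ Metric.closedBall xs δ₀,
      ‖fderiv ℝ (iteratedFDeriv ℝ 2 (obj m n A b h)) z‖ ≤ L := fun z hz => by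
    rw [norm_fderiv_iteratedFDeriv]
    refine norm_iteratedFDeriv_three_obj_le m n hm A h b ?_
    linarith [norm_le_norm_add_norm_sub' z xs, mem_closedBall_iff_norm.1 hz]
  refine le_trans ?_ ((convex_closedBall xs δ₀).norm_image_sub_le_of_norm_fderiv_le
    (fun z _ => hdiff z) hbound (mem_closedBall_iff_norm.2 hy) (mem_closedBall_iff_norm.2 hx))
  have hhess : hess n (obj m n A b h) x - hess n (obj m n A b h) y
      = Matrix.of fun i j => (iteratedFDeriv ℝ 2 (obj m n A b h) x
        - iteratedFDeriv ℝ 2 (obj m n A b h) y)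
          ![EuclideanSpace.single i 1, EuclideanSpace.single j 1] := by
    ext i j
    simp [hess]
  rw [hhess]
  exact specNorm_of_multilinear_le _
end
end

section
/- Let f(x) = ½‖A x^{m−1} − b‖², let x* ∈ ℝⁿ and δ₁ > 0, and set R = ‖x*‖ + δ₁ and M = (m−1)(2m−3)·‖A‖_F²·R^{2m−4} + (m−1)(m−2)·‖b‖·‖A‖_F·R^{m−3}. Then for all x, y ∈ ℝⁿ with ‖x − x*‖ ≤ δ₁ and ‖y − x*‖ ≤ δ₁, the gradient of f is Lipschitz: ‖∇f(x) − ∇f(y)‖ ≤ M·‖x − y‖. -/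
open scoped BigOperators RealInnerProductSpace

noncomputable section

/-- Bound on the variation of one term of the derivative of `x ↦ G (x, …, x)`. -/
theorem norm_update_const_sub_le {E F : Type*} [NormedAddCommGroup E] [NormedSpace ℝ E]
    [NormedAddCommGroup F] [NormedSpace ℝ F] {q : ℕ}
    (G : ContinuousMultilinearMap ℝ (fun _ : Fin (q + 2) => E) F) (k : Fin (q + 2))
    {x y : E} (h : E) {R : ℝ} (hx : ‖x‖ ≤ R) (hy : ‖y‖ ≤ R) :
    ‖G (Function.update (fun _ => x) k h) - G (Function.update (fun _ => y) k h)‖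
      ≤ ‖G‖ * ((q + 1) * (R ^ q * ‖x - y‖ * ‖h‖)) := by
  have hR : 0 ≤ R := (norm_nonneg x).trans hx
  refine (G.norm_image_sub_le' _ _).trans ?_
  gcongr
  rw [← Finset.add_sum_erase _ _ (Finset.mem_univ k)]
  have hk : (∏ j, if j = k then
      ‖Function.update (fun _ => x) k h k - Function.update (fun _ => y) k h k‖ else
      max ‖Function.update (fun _ => x) k h j‖ ‖Function.update (fun _ => y) k h j‖) = 0 :=
    Finset.prod_eq_zero (Finset.mem_univ k) (by simp)
  rw [hk, zero_add]
  have hcard : (Finset.univ.erase k).card = q + 1 := by simp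
  refine (Finset.sum_le_card_nsmul _ _ (R ^ q * ‖x - y‖ * ‖h‖) fun i hi => ?_).trans_eq ?_
  · have hik : i ≠ k := Finset.ne_of_mem_erase hi
    rw [← Finset.mul_prod_erase _ _ (Finset.mem_univ k), ← Finset.mul_prod_erase _ _ hi]
    have hrest : (∏ j ∈ (Finset.univ.erase k).erase i, if j = i then
        ‖Function.update (fun _ => x) k h i - Function.update (fun _ => y) k h i‖ else
        max ‖Function.update (fun _ => x) k h j‖ ‖Function.update (fun _ => y) k h j‖)
        ≤ R ^ q := by
      have hc : ((Finset.univ.erase k).erase i).card = q := by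
        rw [Finset.card_erase_of_mem hi, hcard, Nat.add_sub_cancel]
      refine (Finset.prod_le_prod (g := fun _ => R) ?_ ?_).trans_eq
        (by rw [Finset.prod_const, hc])
      · intro j _; split_ifs <;> positivity
      · intro j hj
        simp only [Finset.mem_erase, Finset.mem_univ, and_true] at hj
        simp [hj.1, hj.2, hx, hy]
    simp only [hik.symm, if_false, if_true, Function.update_self, max_self,
      Function.update_of_ne hik] at hrest ⊢
    calc _ ≤ ‖h‖ * (‖x - y‖ * R ^ q) := by gcongr
      _ = _ := by ring
  · rw [hcard, nsmul_eq_mul]; push_cast; ring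

/-- The derivative of `x ↦ G (x, …, x)`. -/
def diagDeriv {E F : Type*} [NormedAddCommGroup E] [NormedSpace ℝ E]
    [NormedAddCommGroup F] [NormedSpace ℝ F] {p : ℕ}
    (G : ContinuousMultilinearMap ℝ (fun _ : Fin p => E) F) (x : E) : E →L[ℝ] F :=
  (G.linearDeriv fun _ => x).comp (ContinuousLinearMap.pi fun _ => ContinuousLinearMap.id ℝ E)

theorem diagDeriv_apply {E F : Type*} [NormedAddCommGroup E] [NormedSpace ℝ E]
    [NormedAddCommGroup F] [NormedSpace ℝ F] {p : ℕ}
    (G : ContinuousMultilinearMap ℝ (fun _ : Fin p => E) F) (x h : E) :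
    diagDeriv G x h = ∑ k, G (Function.update (fun _ => x) k h) := by
  simp [diagDeriv, ContinuousMultilinearMap.linearDeriv_apply]

theorem hasFDerivAt_diag {E F : Type*} [NormedAddCommGroup E] [NormedSpace ℝ E]
    [NormedAddCommGroup F] [NormedSpace ℝ F] {p : ℕ}
    (G : ContinuousMultilinearMap ℝ (fun _ : Fin p => E) F) (x : E) :
    HasFDerivAt (fun x => G fun _ => x) (diagDeriv G x) x :=
  (G.hasFDerivAt fun _ => x).comp x
    (ContinuousLinearMap.pi fun _ : Fin p => ContinuousLinearMap.id ℝ E).hasFDerivAt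

theorem norm_diagDeriv_le {E F : Type*} [NormedAddCommGroup E] [NormedSpace ℝ E]
    [NormedAddCommGroup F] [NormedSpace ℝ F] {p : ℕ}
    (G : ContinuousMultilinearMap ℝ (fun _ : Fin (p + 1) => E) F) {x : E} {R : ℝ}
    (hx : ‖x‖ ≤ R) : ‖diagDeriv G x‖ ≤ (p + 1) * ‖G‖ * R ^ p := by
  have hR : 0 ≤ R := (norm_nonneg x).trans hx
  refine ContinuousLinearMap.opNorm_le_bound _ (by positivity) fun h => ?_
  rw [diagDeriv_apply]
  refine (norm_sum_le_of_le (f := fun k => G (Function.update (fun _ => x) k h)) _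
    (n := fun _ => ‖G‖ * (‖h‖ * R ^ p)) fun k _ => ?_).trans_eq ?_
  · refine (G.le_opNorm _).trans ?_
    gcongr
    rw [← Finset.mul_prod_erase _ _ (Finset.mem_univ k), Function.update_self]
    gcongr
    refine (Finset.prod_le_prod (g := fun _ => R) (fun _ _ => norm_nonneg _) ?_).trans_eq
      (by simp)
    intro j hj
    rwa [Function.update_of_ne (Finset.ne_of_mem_erase hj)]
  · simp; ring

theorem norm_diagDeriv_sub_le {E F : Type*} [NormedAddCommGroup E] [NormedSpace ℝ E]
    [NormedAddCommGroup F] [NormedSpace ℝ F] {q : ℕ}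
    (G : ContinuousMultilinearMap ℝ (fun _ : Fin (q + 2) => E) F) {x y : E} {R : ℝ}
    (hx : ‖x‖ ≤ R) (hy : ‖y‖ ≤ R) :
    ‖diagDeriv G x - diagDeriv G y‖ ≤ (q + 2) * (q + 1) * ‖G‖ * R ^ q * ‖x - y‖ := by
  have hR : 0 ≤ R := (norm_nonneg x).trans hx
  refine ContinuousLinearMap.opNorm_le_bound _ (by positivity) fun h => ?_
  rw [_root_.sub_apply, diagDeriv_apply, diagDeriv_apply, ← Finset.sum_sub_distrib]
  refine (norm_sum_le_of_le _ fun k _ => norm_update_const_sub_le G k h hx hy).trans_eq ?_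
  simp; ring

theorem norm_diag_sub_le {E F : Type*} [NormedAddCommGroup E] [NormedSpace ℝ E]
    [NormedAddCommGroup F] [NormedSpace ℝ F] {p : ℕ}
    (G : ContinuousMultilinearMap ℝ (fun _ : Fin (p + 1) => E) F) {x y : E} {R : ℝ}
    (hx : ‖x‖ ≤ R) (hy : ‖y‖ ≤ R) :
    ‖(G fun _ => x) - (G fun _ => y)‖ ≤ (p + 1) * ‖G‖ * R ^ p * ‖x - y‖ := by
  refine (G.norm_image_sub_le _ _).trans ?_
  rw [show (fun _ : Fin (p + 1) => x) - (fun _ => y) = fun _ => x - y from rfl]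
  simp only [pi_norm_const, Fintype.card_fin, Nat.add_sub_cancel]
  calc _ ≤ ‖G‖ * ((p + 1 : ℕ) : ℝ) * R ^ p * ‖x - y‖ := by
        gcongr; exact max_le hx hy
    _ = _ := by push_cast; ring

theorem hasGradientAt_half_norm_sub_sq {E F : Type*} [NormedAddCommGroup E]
    [InnerProductSpace ℝ E] [CompleteSpace E] [NormedAddCommGroup F] [InnerProductSpace ℝ F]
    [CompleteSpace F] {g : E → F} {g' : E →L[ℝ] F} {x : E} (hg : HasFDerivAt g g' x) (b : F) :
    HasGradientAt (fun x => (1 / 2) * ‖g x - b‖ ^ 2) (g'.adjoint (g x - b)) x := by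
  rw [hasGradientAt_iff_hasFDerivAt]
  refine ((hg.sub_const b).norm_sq.const_mul (1 / 2)).congr_fderiv ?_
  ext h
  simp [ContinuousLinearMap.adjoint_inner_left]

/-- Lipschitz bound on a ball for the gradient of `x ↦ ½ ‖G (x, …, x) - b‖²`. -/
theorem norm_adjoint_diagDeriv_sub_le {E F : Type*} [NormedAddCommGroup E]
    [InnerProductSpace ℝ E] [CompleteSpace E] [NormedAddCommGroup F] [InnerProductSpace ℝ F]
    [CompleteSpace F] {q : ℕ} (G : ContinuousMultilinearMap ℝ (fun _ : Fin (q + 2) => E) F)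
    (b : F) {a R : ℝ} (ha : ‖G‖ ≤ a) {x y : E} (hx : ‖x‖ ≤ R) (hy : ‖y‖ ≤ R) :
    ‖(diagDeriv G x).adjoint ((G fun _ => x) - b) - (diagDeriv G y).adjoint ((G fun _ => y) - b)‖
      ≤ ((q + 2) * (2 * q + 3) * a ^ 2 * R ^ (2 * q + 2)
          + (q + 2) * (q + 1) * ‖b‖ * a * R ^ q) * ‖x - y‖ := by
  have hR : 0 ≤ R := (norm_nonneg x).trans hx
  have ha₀ : 0 ≤ a := (norm_nonneg G).trans ha
  have hsplit : (diagDeriv G x).adjoint ((G fun _ => x) - b)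
      - (diagDeriv G y).adjoint ((G fun _ => y) - b)
      = (diagDeriv G x).adjoint ((G fun _ => x) - G fun _ => y)
        + (diagDeriv G x - diagDeriv G y).adjoint ((G fun _ => y) - b) := by
    simp only [map_sub, _root_.sub_apply]; abel
  have hres : ‖(G fun _ => y) - b‖ ≤ a * R ^ (q + 2) + ‖b‖ := by
    refine (norm_sub_le _ _).trans ?_
    gcongr
    refine (G.le_opNorm _).trans ?_
    simp only [Finset.prod_const, Finset.card_univ, Fintype.card_fin]
    gcongr
  have hD := norm_diagDeriv_le G hx
  have hdD := norm_diagDeriv_sub_le G hx hy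
  have hdG := norm_diag_sub_le G hx hy
  rw [hsplit]
  refine (norm_add_le _ _).trans ((add_le_add (ContinuousLinearMap.le_opNorm _ _)
    (ContinuousLinearMap.le_opNorm _ _)).trans ?_)
  rw [LinearIsometryEquiv.norm_map, LinearIsometryEquiv.norm_map]
  push_cast at hD hdG
  calc _ ≤ ((q + 1 + 1) * a * R ^ (q + 1)) * ((q + 1 + 1) * a * R ^ (q + 1) * ‖x - y‖)
        + ((q + 2) * (q + 1) * a * R ^ q * ‖x - y‖) * (a * R ^ (q + 2) + ‖b‖) := by
        gcongr
        · exact hD.trans (by gcongr)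
        · exact hdG.trans (by gcongr)
        · exact hdD.trans (by gcongr)
    _ = _ := by ring

/-- The multilinear map `(v₁, …, v_p) ↦ A v₁ ⋯ v_p` contracting all but the first index. -/
def tensorMap {p n : ℕ} (A : (Fin (p + 1) → Fin n) → ℝ) :
    ContinuousMultilinearMap ℝ (fun _ : Fin p => EuclideanSpace ℝ (Fin n))
      (EuclideanSpace ℝ (Fin n)) :=
  ∑ i, ∑ j : Fin p → Fin n, A (Fin.cons i j) •
    ((ContinuousMultilinearMap.mkPiAlgebra ℝ (Fin p) ℝ).compContinuousLinearMap fun l =>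
      EuclideanSpace.proj (j l)).smulRight (EuclideanSpace.single i (1 : ℝ))

theorem tensorMap_apply {p n : ℕ} (A : (Fin (p + 1) → Fin n) → ℝ)
    (v : Fin p → EuclideanSpace ℝ (Fin n)) (i : Fin n) :
    tensorMap A v i = ∑ j : Fin p → Fin n, A (Fin.cons i j) * ∏ l, v l (j l) := by
  simp [tensorMap, Pi.single_apply]

theorem norm_tensorMap_le {p n : ℕ} (A : (Fin (p + 1) → Fin n) → ℝ) :
    ‖tensorMap A‖ ≤ frob A := by
  refine ContinuousMultilinearMap.opNorm_le_bound (Real.sqrt_nonneg _) fun v => ?_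
  refine le_of_sq_le_sq ?_ (mul_nonneg (Real.sqrt_nonneg _)
    (Finset.prod_nonneg fun _ _ => norm_nonneg _))
  have hprod : ∑ j : Fin p → Fin n, (∏ l, v l (j l)) ^ 2 = ∏ l, ‖v l‖ ^ 2 := by
    simp only [EuclideanSpace.real_norm_sq_eq, Finset.prod_univ_sum, Fintype.piFinset_univ,
      Finset.prod_pow]
  have hfrob : frob A ^ 2 = ∑ i, ∑ j : Fin p → Fin n, A (Fin.cons i j) ^ 2 := by
    rw [frob, Real.sq_sqrt (Finset.sum_nonneg fun _ _ => sq_nonneg _),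
      ← (Fin.consEquiv fun _ : Fin (p + 1) => Fin n).sum_comp, Fintype.sum_prod_type]
    rfl
  rw [EuclideanSpace.real_norm_sq_eq, mul_pow, ← Finset.prod_pow, ← hprod, hfrob, Finset.sum_mul]
  refine Finset.sum_le_sum fun i _ => ?_
  rw [tensorMap_apply]
  exact Finset.sum_mul_sq_le_sq_mul_sq _ _ _

theorem tvec_eq_tensorMap {p n : ℕ} (A : (Fin (p + 1) → Fin n) → ℝ)
    (x : EuclideanSpace ℝ (Fin n)) (h : 1 ≤ p + 1) :
    tvec (p + 1) n A x h = tensorMap A fun _ => x := by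
  ext i
  rw [tensorMap_apply]
  simp only [tvec, contra, Fin.append_left_eq_cons]
  rfl

/-- the gradient of `f` is Lipschitz on the ball `‖x - x*‖ ≤ δ₁` with constant
`M = (m-1)(2m-3)‖A‖_F² R^{2m-4} + (m-1)(m-2)‖b‖‖A‖_F R^{m-3}`, `R = ‖x*‖ + δ₁`. -/
theorem gradient_lipschitz (m n : ℕ) (hm : 3 ≤ m) (hn : 1 ≤ n)
    (A : (Fin m → Fin n) → ℝ)
    (hA : ∀ (σ : Equiv.Perm (Fin m)) (i : Fin m → Fin n), A (i ∘ σ) = A i)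
    (b : EuclideanSpace ℝ (Fin n))
    (xs : EuclideanSpace ℝ (Fin n)) (δ₁ : ℝ) (hδ₁ : 0 < δ₁) :
    ∀ x y : EuclideanSpace ℝ (Fin n), ‖x - xs‖ ≤ δ₁ → ‖y - xs‖ ≤ δ₁ →
      ‖gradient (obj m n A b (by omega)) x - gradient (obj m n A b (by omega)) y‖
        ≤ (((m : ℝ) - 1) * (2 * (m : ℝ) - 3) * frob A ^ 2 * (‖xs‖ + δ₁) ^ (2 * m - 4)
            + ((m : ℝ) - 1) * ((m : ℝ) - 2) * ‖b‖ * frob A * (‖xs‖ + δ₁) ^ (m - 3))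
          * ‖x - y‖ := by
  obtain ⟨q, rfl⟩ : ∃ q, m = q + 3 := ⟨m - 3, by omega⟩
  intro x y hx hy
  have hball : ∀ z : EuclideanSpace ℝ (Fin n), ‖z - xs‖ ≤ δ₁ → ‖z‖ ≤ ‖xs‖ + δ₁ := fun z hz => by
    linarith [norm_le_norm_add_norm_sub' z xs]
  have hgrad : ∀ z, gradient (obj (q + 3) n A b (by omega)) z
      = (diagDeriv (tensorMap A) z).adjoint ((tensorMap A fun _ => z) - b) := fun z => by
    have hobj : obj (q + 3) n A b (by omega)
        = fun z => (1 / 2) * ‖(tensorMap A fun _ => z) - b‖ ^ 2 := by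
      funext z
      rw [obj, tvec_eq_tensorMap]
    rw [hobj]
    exact (hasGradientAt_half_norm_sub_sq (hasFDerivAt_diag (tensorMap A) z) b).gradient
  rw [hgrad, hgrad]
  refine (norm_adjoint_diagDeriv_sub_le (tensorMap A) b (norm_tensorMap_le A)
    (hball x hx) (hball y hy)).trans_eq ?_
  rw [show 2 * (q + 3) - 4 = 2 * q + 2 by omega, Nat.add_sub_cancel]
  push_cast
  ring
end
end

section
/- Fix an integer m ≥ 3 and n ≥ 2. Let u₁ = ((−1)^m, 1, …, 1)ᵀ ∈ ℝⁿ, u₂ = ((−1)^{m−1}, 1, …, 1)ᵀ ∈ ℝⁿ, let A be the symmetric tensor with entries a_{i₁⋯i_m} = (u₁)_{i₁}⋯(u₁)_{i_m} + (u₂)_{i₁}⋯(u₂)_{i_m}, b = u₁ + (−1)^{m−1}·u₂, f(x) = ½‖A x^{m−1} − b‖², and x* = e₁. Then for every index set T ⊆ {1,…,n} with 1 ∈ T and |T| ≤ 2, the principal submatrix ∇²_T f(x*) of the Hessian of f at x* is positive definite. -/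
open scoped BigOperators RealInnerProductSpace

noncomputable section

section HalfNormSq

variable {E F : Type*} [NormedAddCommGroup E] [NormedSpace ℝ E]
  [NormedAddCommGroup F] [InnerProductSpace ℝ F]

theorem fderiv_half_norm_sq {r : E → F} (hr : Differentiable ℝ r) :
    fderiv ℝ (fun y => (1 / 2 : ℝ) * ‖r y‖ ^ 2) =
      fun y => (innerSL ℝ (r y)).comp (fderiv ℝ r y) := by
  funext y
  rw [((hr y).hasFDerivAt.norm_sq.const_mul (1 / 2 : ℝ)).fderiv]
  ext v
  simp

/-- At a zero of the residual `r`, the Hessian of `½ ‖r‖²` is the Gauss–Newton form. -/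
theorem iteratedFDeriv_two_half_norm_sq {r : E → F} (hr : ContDiff ℝ 2 r) {x : E}
    (hx : r x = 0) (v w : E) :
    iteratedFDeriv ℝ 2 (fun y => (1 / 2 : ℝ) * ‖r y‖ ^ 2) x ![v, w] =
      inner ℝ (fderiv ℝ r x v) (fderiv ℝ r x w) := by
  have hd : Differentiable ℝ r := hr.differentiable (by norm_num)
  have hd' : Differentiable ℝ (fderiv ℝ r) :=
    (hr.fderiv_right (m := 1) (by norm_num)).differentiable (by norm_num)
  have h := (((innerSL ℝ (E := F)).hasFDerivAt.comp x (hd x).hasFDerivAt).clm_comp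
    (hd' x).hasFDerivAt).fderiv
  rw [iteratedFDeriv_two_apply, fderiv_half_norm_sq hd]
  erw [h]
  simp [hx]
  rfl

end HalfNormSq

theorem tvec_of_rank_two {m n : ℕ} (u w : EuclideanSpace ℝ (Fin n))
    {A : (Fin m → Fin n) → ℝ} (hA : ∀ i, A i = (∏ k, u (i k)) + ∏ k, w (i k))
    (x : EuclideanSpace ℝ (Fin n)) (h : 1 ≤ m) :
    tvec m n A x h = inner ℝ u x ^ (m - 1) • u + inner ℝ w x ^ (m - 1) • w := by
  have key : ∀ (v : EuclideanSpace ℝ (Fin n)) (i : Fin n),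
      ∑ j : Fin (m - 1) → Fin n,
        (∏ k : Fin m, v (Fin.append ![i] j (Fin.cast (by omega) k))) * ∏ l, x (j l) =
      inner ℝ v x ^ (m - 1) * v i := by
    intro v i
    have hcast : ∀ j : Fin (m - 1) → Fin n,
        ∏ k : Fin m, v (Fin.append ![i] j (Fin.cast (by omega) k)) =
          v i * ∏ l, v (j l) := by
      intro j
      refine (Fintype.prod_equiv (finCongr (show m = 1 + (m - 1) by omega)) _
        (fun k => v (Fin.append ![i] j k)) (fun k => rfl)).trans ?_
      rw [Fin.prod_univ_add]
      simp
    simp only [hcast, PiLp.inner_apply, Fintype.sum_pow, Finset.sum_mul]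
    refine Finset.sum_congr rfl fun j _ => ?_
    simp only [RCLike.inner_apply, conj_trivial, Finset.prod_mul_distrib]
    ring
  ext i
  simp only [tvec, contra, hA, add_mul, Finset.sum_add_distrib]
  simpa using congrArg₂ (· + ·) (key u i) (key w i)

theorem hasFDerivAt_inner_pow_smul {E : Type*} [NormedAddCommGroup E] [InnerProductSpace ℝ E]
    (u x : E) (k : ℕ) :
    HasFDerivAt (fun y => inner ℝ u y ^ k • u)
      (((k * inner ℝ u x ^ (k - 1) : ℝ) • innerSL ℝ u).smulRight u) x := by
  have h := (((innerSL ℝ u).hasFDerivAt (x := x)).pow k).smul_const u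
  simpa only [innerSL_apply_apply, nsmul_eq_mul] using h

theorem Finset.exists_forall_eq_or_eq_of_card_le_two {α : Type*} [DecidableEq α] {T : Finset α} {a : α}
    (ha : a ∈ T) (hT : T.card ≤ 2) : ∃ c ∈ T, ∀ i ∈ T, i = a ∨ i = c := by
  have h1 : (T.erase a).card ≤ 1 := by
    rw [Finset.card_erase_of_mem ha]; omega
  rcases (T.erase a).eq_empty_or_nonempty with h | ⟨c, hc⟩
  · exact ⟨a, ha, fun i hi => by
      by_contra! hne
      simpa [h] using Finset.mem_erase.2 ⟨hne.1, hi⟩⟩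
  · refine ⟨c, Finset.mem_of_mem_erase hc, fun i hi => or_iff_not_imp_left.2 fun hne => ?_⟩
    exact Finset.card_le_one.1 h1 i (Finset.mem_erase.2 ⟨hne, hi⟩) c hc

/-- in the setting of the example (`A = u₁^m + u₂^m`, `b = u₁ + (-1)^{m-1}u₂`,
`x* = e₁`, `s = 1`), every principal submatrix `∇²_T f(x*)` with `1 ∈ T` and `|T| ≤ 2` is
positive definite. -/
theorem example_assumption_holds (m n : ℕ) (hm : 3 ≤ m) (hn : 2 ≤ n)
    (u₁ u₂ : EuclideanSpace ℝ (Fin n))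
    (hu₁ : ∀ i : Fin n, u₁ i = if (i : ℕ) = 0 then (-1 : ℝ) ^ m else 1)
    (hu₂ : ∀ i : Fin n, u₂ i = if (i : ℕ) = 0 then (-1 : ℝ) ^ (m - 1) else 1)
    (A : (Fin m → Fin n) → ℝ)
    (hA : ∀ i : Fin m → Fin n, A i = (∏ k, u₁ (i k)) + ∏ k, u₂ (i k))
    (b : EuclideanSpace ℝ (Fin n))
    (hb : ∀ i : Fin n, b i = u₁ i + (-1 : ℝ) ^ (m - 1) * u₂ i)
    (xs : EuclideanSpace ℝ (Fin n))
    (hxs : ∀ i : Fin n, xs i = if (i : ℕ) = 0 then (1 : ℝ) else 0) :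
    ∀ T : Finset (Fin n), (⟨0, by omega⟩ : Fin n) ∈ T → T.card ≤ 2 →
      (subMat (hess n (obj m n A b (by omega)) xs) T).PosDef := by
  intro T h0 hT
  set z : Fin n := ⟨0, by omega⟩ with hz
  set o : Fin n := ⟨1, by omega⟩ with ho
  have hxs' : xs = EuclideanSpace.single z 1 := by
    ext i
    simp [hxs, hz, Fin.ext_iff]
  have hsingle : ∀ (v : EuclideanSpace ℝ (Fin n)) (i : Fin n),
      inner ℝ v (EuclideanSpace.single i (1 : ℝ)) = v i := by
    intro v i
    simp [EuclideanSpace.inner_single_right]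
  obtain ⟨k, rfl⟩ : ∃ k, m = k + 1 := ⟨m - 1, by omega⟩
  simp only [Nat.add_sub_cancel] at hu₂ hb
  have hu₁z : u₁ z = (-1) ^ (k + 1) := by simp [hu₁, hz]
  have hu₂z : u₂ z = (-1) ^ k := by simp [hu₂, hz]
  have hε : ((-1 : ℝ) ^ k) * (-1) ^ k = 1 := by rw [← mul_pow]; simp
  have hp : ((-1 : ℝ) ^ (k + 1)) ^ k = 1 := by
    rw [← pow_mul, mul_comm]; exact (Nat.even_mul_succ_self k).neg_one_pow
  have hq : ((-1 : ℝ) ^ k) ^ k = (-1) ^ k := by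
    rcases Nat.even_or_odd k with h | h <;> simp [h.neg_one_pow]
  set r : EuclideanSpace ℝ (Fin n) → EuclideanSpace ℝ (Fin n) :=
    fun x => inner ℝ u₁ x ^ k • u₁ + inner ℝ u₂ x ^ k • u₂ - b with hr
  have hobj : obj (k + 1) n A b (by omega) = fun x => (1 / 2 : ℝ) * ‖r x‖ ^ 2 := by
    funext x
    simp only [obj, tvec_of_rank_two u₁ u₂ hA, hr, Nat.add_sub_cancel]
  have hr0 : r xs = 0 := by
    ext i
    simp [hr, hxs', hsingle, hu₁z, hu₂z, hp, hq, hb]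
  have hrc : ContDiff ℝ 2 r := by
    have h : ∀ u : EuclideanSpace ℝ (Fin n), ContDiff ℝ 2 fun x => inner ℝ u x ^ k • u :=
      fun u => ((contDiff_const.inner ℝ contDiff_id).pow k).smul contDiff_const
    exact ((h u₁).add (h u₂)).sub contDiff_const
  set p : ℝ := k * ((-1) ^ (k + 1)) ^ (k - 1) with hpdef
  set q : ℝ := k * ((-1) ^ k) ^ (k - 1) with hqdef
  have hk : (k : ℝ) ≠ 0 := by
    have : k ≠ 0 := by omega
    exact_mod_cast this
  have hp0 : p ≠ 0 := by simp [hpdef, hk]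
  have hq0 : q ≠ 0 := by simp [hqdef, hk]
  have hrd : ∀ i, fderiv ℝ r xs (EuclideanSpace.single i 1) =
      (p * u₁ i) • u₁ + (q * u₂ i) • u₂ := by
    intro i
    have h : HasFDerivAt r _ xs := ((hasFDerivAt_inner_pow_smul u₁ xs k).add
      (hasFDerivAt_inner_pow_smul u₂ xs k)).sub_const b
    rw [h.fderiv]
    simp [hxs', hsingle, hu₁z, hu₂z, hpdef, hqdef]
  have hgram : subMat (hess n (obj (k + 1) n A b (by omega)) xs) T =
      Matrix.gram ℝ fun i : {i // i ∈ T} => (p * u₁ i) • u₁ + (q * u₂ i) • u₂ := by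
    ext i j
    simp only [subMat, hess, Matrix.of_apply, Matrix.gram_apply, hobj,
      iteratedFDeriv_two_half_norm_sq hrc hr0, hrd]
  rw [hgram]
  refine Matrix.posDef_gram_of_linearIndependent ?_
  rw [Fintype.linearIndependent_iff]
  intro g hg
  have hcoord : ∀ l, p * (∑ i, g i * u₁ i) * u₁ l + q * (∑ i, g i * u₂ i) * u₂ l = 0 := by
    intro l
    have := congrArg (fun v : EuclideanSpace ℝ (Fin n) => v l) hg
    simp only [WithLp.ofLp_sum, WithLp.ofLp_smul, WithLp.ofLp_add, Finset.sum_apply,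
      Pi.smul_apply, Pi.add_apply, smul_eq_mul, WithLp.ofLp_zero, Pi.zero_apply] at this
    rw [← this, Finset.mul_sum, Finset.mul_sum, Finset.sum_mul, Finset.sum_mul,
      ← Finset.sum_add_distrib]
    exact Finset.sum_congr rfl fun i _ => by ring
  have hz' := hcoord z
  have ho' := hcoord o
  have hu₁o : u₁ o = 1 := by simp [hu₁, ho]
  have hu₂o : u₂ o = 1 := by simp [hu₂, ho]
  rw [hu₁z, hu₂z] at hz'
  rw [hu₁o, hu₂o] at ho'
  set s₁ := ∑ i, g i * u₁ i with hs₁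
  set s₂ := ∑ i, g i * u₂ i with hs₂
  have hdiff : p * s₁ - q * s₂ = 0 := by
    linear_combination (-(-1 : ℝ) ^ k) * hz' - (p * s₁ - q * s₂) * hε
  have hs₁0 : s₁ = 0 := by
    have : p * s₁ = 0 := by linarith
    exact (mul_eq_zero.1 this).resolve_left hp0
  have hs₂0 : s₂ = 0 := by
    have : q * s₂ = 0 := by linarith
    exact (mul_eq_zero.1 this).resolve_left hq0
  have hgz : g ⟨z, h0⟩ = 0 := by
    have hsub : s₂ - s₁ = g ⟨z, h0⟩ * (2 * (-1) ^ k) := by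
      rw [hs₁, hs₂, ← Finset.sum_sub_distrib, Finset.sum_eq_single ⟨z, h0⟩]
      · rw [hu₁z, hu₂z]; ring
      · rintro ⟨i, hi⟩ - hne
        have : (i : ℕ) ≠ 0 := fun h => hne (Subtype.ext (Fin.ext h))
        simp [hu₁, hu₂, this]
      · simp
    rw [hs₁0, hs₂0, sub_zero] at hsub
    simpa using hsub.symm
  obtain ⟨c, hcT, hc⟩ := Finset.exists_forall_eq_or_eq_of_card_le_two h0 hT
  have hgc : g ⟨c, hcT⟩ = 0 := by
    by_cases hcz : c = z
    · subst hcz; exact hgz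
    · have hs : s₁ = g ⟨c, hcT⟩ * u₁ c := by
        rw [hs₁, Finset.sum_eq_single ⟨c, hcT⟩]
        · rintro ⟨i, hi⟩ - hne
          rcases hc i hi with rfl | rfl
          · rw [hgz, zero_mul]
          · exact absurd rfl hne
        · simp
      have : (c : ℕ) ≠ 0 := fun h => hcz (Fin.ext h)
      simpa [hu₁, this, hs₁0] using hs.symm
  rintro ⟨i, hi⟩
  rcases hc i hi with rfl | rfl
  exacts [hgz, hgc]
end
end

section
/- Let f(x) = ½‖A x^{m−1} − b‖², let s ∈ {1,…,n−1}, η > 0, and let x* ∈ ℝⁿ with ‖x*‖₀ ≤ s. Then x* ∈ P_s(x* − η∇f(x*)) if and only if the following hold: (i) if ‖x*‖₀ < s then ∇f(x*) = 0; (ii) if ‖x*‖₀ = s then ∇_i f(x*) = 0 for every i ∈ supp(x*), and |∇_j f(x*)| ≤ (min_{i ∈ supp(x*)} |x*_i|)/η for every j ∉ supp(x*). -/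
open scoped BigOperators RealInnerProductSpace

noncomputable section

lemma mem_supp {n : ℕ} {x : EuclideanSpace ℝ (Fin n)} {i : Fin n} :
    i ∈ supp x ↔ x i ≠ 0 := by
  simp [supp]

/-- Expanding the squares, the projection property becomes a quadratic inequality in the
displacement `w - x`. -/
lemma inProj_sub_smul_iff {n s : ℕ} {x : EuclideanSpace ℝ (Fin n)} (hx : spars x ≤ s)
    (η : ℝ) (g : EuclideanSpace ℝ (Fin n)) :
    inProj s (x - η • g) x ↔ ∀ w : EuclideanSpace ℝ (Fin n), spars w ≤ s →
      0 ≤ ∑ k, (2 * η * g k * (w k - x k) + (w k - x k) ^ 2) := by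
  simp only [inProj, hx, true_and]
  refine forall₂_congr fun w _ => ?_
  rw [← sq_le_sq₀ (norm_nonneg _) (norm_nonneg _), EuclideanSpace.real_norm_sq_eq,
    EuclideanSpace.real_norm_sq_eq, ← sub_nonneg, ← Finset.sum_sub_distrib]
  refine iff_of_eq (congrArg _ (Finset.sum_congr rfl fun k _ => ?_))
  simp only [PiLp.sub_apply, PiLp.smul_apply, smul_eq_mul]
  ring

/-- Replacing the `i`-th coordinate of `x` by a gradient step shows that `g` vanishes at `i`
whenever `i` may be added to the support. -/
lemma apply_eq_zero_of_inProj {n s : ℕ} {x g : EuclideanSpace ℝ (Fin n)} {η : ℝ} (hη : 0 < η)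
    (h : inProj s (x - η • g) x) {i : Fin n} (hi : (insert i (supp x)).card ≤ s) :
    g i = 0 := by
  have key := (inProj_sub_smul_iff h.1 η g).1 h (x - EuclideanSpace.single i (η * g i)) <| by
    refine (Finset.card_le_card fun k hk => ?_).trans hi
    by_cases hki : k = i
    · simp [hki]
    · simpa [mem_supp, hki] using hk
  rw [Finset.sum_eq_single i (fun k _ hki => by simp [hki]) (by simp)] at key
  simp only [PiLp.sub_apply, PiLp.single_apply, if_true] at key
  have : (η * g i) ^ 2 ≤ 0 := by linarith
  simpa [hη.ne'] using this.antisymm (sq_nonneg _)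

/-- Exchanging an index `i` of the support for an index `j` outside it. -/
lemma abs_apply_le_of_inProj {n s : ℕ} {x g : EuclideanSpace ℝ (Fin n)} {η : ℝ} (hη : 0 < η)
    (h : inProj s (x - η • g) x) {i j : Fin n} (hi : i ∈ supp x) (hj : j ∉ supp x)
    (hg : g i = 0) : |g j| ≤ |x i| / η := by
  have hij : i ≠ j := fun e => hj (e ▸ hi)
  have key := (inProj_sub_smul_iff h.1 η g).1 h
    (x - EuclideanSpace.single i (x i) - EuclideanSpace.single j (η * g j)) <| by
    have hcard : (insert j ((supp x).erase i)).card = spars x := by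
      rw [Finset.card_insert_of_notMem (by simp [hj]), Finset.card_erase_add_one hi, spars]
    refine (Finset.card_le_card fun k hk => ?_).trans (hcard.trans_le h.1)
    by_cases hkj : k = j
    · simp [hkj]
    by_cases hki : k = i
    · subst hki
      simp [mem_supp, hkj] at hk
    · simpa [mem_supp, hki, hkj] using hk
  rw [Fintype.sum_eq_add i j hij (fun k hk => by simp [hk.1, hk.2])] at key
  simp only [PiLp.sub_apply, PiLp.single_apply, if_true, hij, hij.symm, if_false, hg] at key
  rw [le_div_iff₀ hη, ← abs_of_pos hη, ← abs_mul]
  exact sq_le_sq.1 (by linarith)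

/-- The exchange conditions are sufficient for a vector of full sparsity `s`. -/
lemma inProj_of_abs_apply_le {n s : ℕ} (hs : 1 ≤ s) {x g : EuclideanSpace ℝ (Fin n)} {η : ℝ}
    (hη : 0 < η) (hx : spars x = s) (hzero : ∀ i ∈ supp x, g i = 0)
    (hle : ∀ j, j ∉ supp x → ∀ i ∈ supp x, |g j| ≤ |x i| / η) :
    inProj s (x - η • g) x := by
  refine (inProj_sub_smul_iff hx.le η g).2 fun w hw => ?_
  obtain ⟨i, hi, hmin⟩ := (supp x).exists_min_image (fun i => |x i|)
    (Finset.card_pos.1 (by rw [← spars]; omega))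
  have hterm : ∀ k, x i ^ 2 * ((if k ∈ supp x then 1 else 0) - (if k ∈ supp w then 1 else 0)) ≤
      2 * η * g k * (w k - x k) + (w k - x k) ^ 2 := by
    intro k
    by_cases hk : k ∈ supp x <;> by_cases hkw : k ∈ supp w
    · simp only [hk, hkw, if_true, hzero k hk]
      nlinarith [sq_nonneg (w k - x k)]
    · have hwk : w k = 0 := by simpa [mem_supp] using hkw
      have := sq_le_sq.2 (hmin k hk)
      simp only [hk, hkw, if_true, if_false, hzero k hk, hwk]
      linarith
    · have hxk : x k = 0 := by simpa [mem_supp] using hk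
      have hb := hle k hk i hi
      rw [le_div_iff₀ hη, ← abs_of_pos hη, ← abs_mul] at hb
      have := sq_le_sq.2 hb
      simp only [hk, hkw, if_true, if_false, hxk]
      nlinarith [sq_nonneg (η * g k + w k)]
    · have hxk : x k = 0 := by simpa [mem_supp] using hk
      have hwk : w k = 0 := by simpa [mem_supp] using hkw
      simp [hk, hkw, hxk, hwk]
  refine le_trans ?_ (Finset.sum_le_sum fun k _ => hterm k)
  rw [← Finset.mul_sum, Finset.sum_sub_distrib, Finset.sum_boole, Finset.sum_boole,
    Finset.filter_univ_mem, Finset.filter_univ_mem]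
  exact mul_nonneg (sq_nonneg _) (sub_nonneg.2 (by exact_mod_cast hw.trans hx.ge))

/-- characterization of `η`-stationary points:
`x* ∈ P_s(x* - η∇f(x*))` iff (i) `∇f(x*) = 0` when `‖x*‖₀ < s`, and (ii) when `‖x*‖₀ = s`,
`∇_i f(x*) = 0` on the support and `|∇_j f(x*)| ≤ min_{i ∈ supp(x*)} |x*_i| / η` off it. -/
theorem eta_stationary_characterization (m n : ℕ) (hm : 3 ≤ m) (hn : 1 ≤ n)
    (A : (Fin m → Fin n) → ℝ)
    (hA : ∀ (σ : Equiv.Perm (Fin m)) (i : Fin m → Fin n), A (i ∘ σ) = A i)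
    (b : EuclideanSpace ℝ (Fin n))
    (s : ℕ) (hs1 : 1 ≤ s) (hs2 : s < n)
    (η : ℝ) (hη : 0 < η)
    (xs : EuclideanSpace ℝ (Fin n)) (hxs : spars xs ≤ s) :
    inProj s (xs - η • gradient (obj m n A b (by omega)) xs) xs ↔
      ((spars xs < s → gradient (obj m n A b (by omega)) xs = 0) ∧
       (spars xs = s →
         (∀ i ∈ supp xs, gradient (obj m n A b (by omega)) xs i = 0) ∧
         ∀ j, j ∉ supp xs → ∀ i ∈ supp xs,
           |gradient (obj m n A b (by omega)) xs j| ≤ |xs i| / η)) := by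
  generalize gradient (obj m n A b (by omega)) xs = g
  constructor
  · intro h
    refine ⟨fun hlt => ?_, fun _ => ?_⟩
    · ext i
      exact apply_eq_zero_of_inProj hη h ((Finset.card_insert_le _ _).trans hlt)
    · have hzero : ∀ i ∈ supp xs, g i = 0 := fun i hi =>
        apply_eq_zero_of_inProj hη h (by rw [Finset.insert_eq_of_mem hi]; exact hxs)
      exact ⟨hzero, fun j hj i hi => abs_apply_le_of_inProj hη h hi hj (hzero i hi)⟩
  · rintro ⟨hlt, heq⟩
    rcases hxs.lt_or_eq with h | h
    · rw [hlt h]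
      refine (inProj_sub_smul_iff hxs η 0).2 fun w _ => Finset.sum_nonneg fun k _ => ?_
      simpa using sq_nonneg (w k - xs k)
    · exact inProj_of_abs_apply_le hs1 hη h (heq h).1 (heq h).2
end
end

section
/- Let f(x) = ½‖A x^{m−1} − b‖², s ∈ {1,…,n−1}, η > 0, and let x* ∈ ℝⁿ with ‖x*‖₀ ≤ s satisfy x* ∈ P_s(x* − η∇f(x*)). Suppose that for every index set T with supp(x*) ⊆ T and |T| ≤ 2s, the principal submatrix ∇²_T f(x*) is positive definite. Then there exists δ > 0 such that for every x ∈ N_s(x*,δ) and every T ∈ T(x;η), the principal submatrix ∇²_T f(x) is positive definite. -/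
open scoped BigOperators RealInnerProductSpace

noncomputable section

open Topology Filter in
theorem Matrix.PosDef.eventually {X ι : Type*} [TopologicalSpace X] [Fintype ι]
    {M : X → Matrix ι ι ℝ} (hM : Continuous M) (hherm : ∀ x, (M x).IsHermitian) {x₀ : X}
    (h : (M x₀).PosDef) : ∀ᶠ x in 𝓝 x₀, (M x).PosDef := by
  have hcont : Continuous fun z : X × (ι → ℝ) => star z.2 ⬝ᵥ (M z.1).mulVec z.2 :=
    continuous_snd.star.dotProduct ((hM.comp continuous_fst).matrix_mulVec continuous_snd)
  have hsphere : ∀ᶠ x in 𝓝 x₀, ∀ v ∈ Metric.sphere (0 : ι → ℝ) 1,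
      0 < star v ⬝ᵥ (M x).mulVec v := by
    refine (isCompact_sphere _ _).eventually_forall_of_forall_eventually fun v hv => ?_
    exact hcont.continuousAt.eventually_const_lt
      (h.dotProduct_mulVec_pos (ne_zero_of_mem_unit_sphere ⟨v, hv⟩))
  filter_upwards [hsphere] with x hx
  refine .of_dotProduct_mulVec_pos (hherm x) fun v hv => ?_
  have hv' : 0 < ‖v‖ := norm_pos_iff.mpr hv
  have hpos := hx (‖v‖⁻¹ • v) (by simp [norm_smul, hv'.ne'])
  rw [star_smul, Matrix.mulVec_smul, smul_dotProduct, dotProduct_smul, smul_eq_mul,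
    smul_eq_mul, star_trivial] at hpos
  exact pos_of_mul_pos_right (pos_of_mul_pos_right hpos (by positivity)) (by positivity)

theorem contDiff_obj (m n : ℕ) (A : (Fin m → Fin n) → ℝ) (b : EuclideanSpace ℝ (Fin n))
    (h : 1 ≤ m) {k : ℕ∞} : ContDiff ℝ k (obj m n A b h) := by
  have htvec : ContDiff ℝ k fun x => tvec m n A x h := by
    refine (EuclideanSpace.equiv (Fin n) ℝ).symm.contDiff.comp (contDiff_pi.mpr fun i => ?_)
    unfold contra
    fun_prop
  exact contDiff_const.mul ((htvec.sub contDiff_const).norm_sq ℝ)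

theorem continuous_hess {n : ℕ} {f : EuclideanSpace ℝ (Fin n) → ℝ} (hf : ContDiff ℝ 2 f) :
    Continuous (hess n f) := by
  refine continuous_matrix fun i j => ?_
  have := hf.continuous_iteratedFDeriv (m := 2) le_rfl
  exact (continuous_eval_const _).comp this

theorem isHermitian_hess {n : ℕ} {f : EuclideanSpace ℝ (Fin n) → ℝ} (hf : ContDiff ℝ 2 f)
    (x : EuclideanSpace ℝ (Fin n)) : (hess n f x).IsHermitian := by
  ext i j
  exact IsSymmSndFDerivAt.iteratedFDeriv_cons
    (hf := hf.contDiffAt.isSymmSndFDerivAt (by simp))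

theorem Matrix.PosDef.subMat_mono {n : ℕ} {M : Matrix (Fin n) (Fin n) ℝ} {S T : Finset (Fin n)}
    (hT : (subMat M T).PosDef) (hST : S ⊆ T) : (subMat M S).PosDef :=
  hT.submatrix (Subtype.map_injective hST Function.injective_id)

/-- nonsingularity (positive definiteness) of restricted Hessians near an
`η`-stationary point `x*` at which all principal submatrices `∇²_T f(x*)`,
`supp(x*) ⊆ T`, `|T| ≤ 2s`, are positive definite. -/
theorem restricted_hessian_posdef_near (m n : ℕ) (hm : 3 ≤ m) (hn : 1 ≤ n)
    (A : (Fin m → Fin n) → ℝ)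
    (hA : ∀ (σ : Equiv.Perm (Fin m)) (i : Fin m → Fin n), A (i ∘ σ) = A i)
    (b : EuclideanSpace ℝ (Fin n))
    (s : ℕ) (hs1 : 1 ≤ s) (hs2 : s < n)
    (η : ℝ) (hη : 0 < η)
    (xs : EuclideanSpace ℝ (Fin n)) (hxs : spars xs ≤ s)
    (hstat : inProj s (xs - η • gradient (obj m n A b (by omega)) xs) xs)
    (hposdef : ∀ T : Finset (Fin n), supp xs ⊆ T → T.card ≤ 2 * s →
      (subMat (hess n (obj m n A b (by omega)) xs) T).PosDef) :
    ∃ δ > (0 : ℝ), ∀ x : EuclideanSpace ℝ (Fin n),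
      supp xs ⊆ supp x → spars x ≤ s → ‖x - xs‖ < δ →
      ∀ T : Finset (Fin n), Tmem (obj m n A b (by omega)) s η x T →
        (subMat (hess n (obj m n A b (by omega)) x) T).PosDef := by
  have hf : ContDiff ℝ 2 (obj m n A b (by omega)) := contDiff_obj m n A b _ (k := 2)
  have hev : ∀ᶠ x in nhds xs, ∀ T : Finset (Fin n), T.card = s →
      (subMat (hess n (obj m n A b (by omega)) x) T).PosDef := by
    refine Filter.eventually_all.mpr fun T => Filter.eventually_imp_distrib_left.mpr fun hT => ?_
    have hposdefT : (subMat (hess n (obj m n A b (by omega)) xs) T).PosDef := by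
      refine (hposdef (T ∪ supp xs) Finset.subset_union_right ?_).subMat_mono
        Finset.subset_union_left
      have hcard := Finset.card_union_le T (supp xs)
      have hsupp : (supp xs).card ≤ s := hxs
      omega
    refine hposdefT.eventually (M := fun x => subMat (hess n (obj m n A b (by omega)) x) T)
      ?_ fun x => (isHermitian_hess hf x).submatrix _
    exact (continuous_hess hf).matrix_submatrix _ _
  obtain ⟨δ, hδ, hball⟩ := Metric.eventually_nhds_iff.mp hev
  exact ⟨δ, hδ, fun x _ _ hx T hT => hball (by rwa [dist_eq_norm]) T hT.1⟩
end
end
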